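/- arXiv:2602.14213 — 3 statements merged into one kernel-verified Lean document; each statement's English description precedes it below -/
import Mathlib

section
/- Under the setup where A is symmetric integral, p odd, rank_p W = n−1, z₀ ≢ 0 (mod p) with (A−λ₀I)z₀ ≡ 0, z₀ᵀz₀ ≡ 0, and Wᵀz₀ ≡ 0 all mod p^τ: the Smith normal form over ℤ/p^τℤ of the n × (n+1) matrix M = [A − λ₀ I, z₀] is [diag(1,…,1,0), 0] (n−1 unit invariant factors), and every integer vector z with z₀ᵀ z ≡ 0 (mod p^τ) lies in the ℤ/p^τℤ-span of the columns of M. -/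
open Matrix

/-- The walk matrix `[e, Ae, …, A^{n-1}e]` of a square matrix `A`. -/
noncomputable def walkMatrix {n : ℕ} {R : Type*} [CommRing R]
    (A : Matrix (Fin n) (Fin n) R) : Matrix (Fin n) (Fin n) R :=
  Matrix.of fun i j => ((A ^ (j : ℕ)) *ᵥ (fun _ => 1)) i

/-- The `m × n` matrix with diagonal entries `d 0, …, d (r-1)` in the top-left
corner and zeros elsewhere (a Smith-normal-form shaped matrix). -/
def snfMat {R : Type*} [Zero R] (m n r : ℕ) (d : Fin r → R) :
    Matrix (Fin m) (Fin n) R :=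
  Matrix.of fun i j => if h : (i : ℕ) = (j : ℕ) ∧ (i : ℕ) < r then d ⟨i, h.2⟩ else 0

/-- If the walk matrix of `A` has rank `n - 1`, its column space is `z^⊥`, and `z` is an isotropic
`lam`-eigenvector, then the `lam`-eigenspace of `A` meets `z^⊥` only in the line through `z`:
`A - lam` has corank at most one on a cyclic subspace. -/
theorem walkMatrix_eigenvector_orthogonal_eq_smul {F : Type*} [Field F] {n : ℕ}
    (A : Matrix (Fin n) (Fin n) F) (hrank : (walkMatrix A).rank = n - 1)
    (lam : F) (z : Fin n → F) (hz : z ≠ 0) (hAz : A *ᵥ z = lam • z) (hzz : z ⬝ᵥ z = 0)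
    (hWz : z ᵥ* walkMatrix A = 0) (y : Fin n → F) (hAy : A *ᵥ y = lam • y) (hzy : z ⬝ᵥ y = 0) :
    ∃ a : F, y = a • z := by
  set W := walkMatrix A with hW
  let V : Submodule F (Fin n → F) := LinearMap.ker (dotProductBilin F F z)
  have mem_V (v : Fin n → F) : v ∈ V ↔ z ⬝ᵥ v = 0 := Iff.rfl
  let T : (Fin n → F) →ₗ[F] (Fin n → F) := A.mulVecLin - lam • LinearMap.id
  have T_apply (v : Fin n → F) : T v = A *ᵥ v - lam • v := rfl
  let e : Fin n → F := fun _ => 1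
  have hrange : LinearMap.range W.mulVecLin = V := by
    apply Submodule.eq_of_le_of_finrank_le
    · rintro _ ⟨c, rfl⟩
      rw [mem_V, mulVecLin_apply, dotProduct_mulVec, hWz, zero_dotProduct]
    · have hV : V ≠ ⊤ := by
        intro h
        refine hz (funext fun i => ?_)
        have hi : Pi.single i (1 : F) ∈ V := h ▸ Submodule.mem_top
        simpa [mem_V] using hi
      have hlt := Submodule.finrank_lt hV
      rw [Module.finrank_fin_fun] at hlt
      have hr : Module.finrank F (LinearMap.range W.mulVecLin) = n - 1 := hrank
      omega
  have col_eq (j : Fin n) : W *ᵥ Pi.single j 1 = (A ^ (j : ℕ)) *ᵥ e := by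
    ext i
    simp [hW, walkMatrix, e]
  have pow_mem_V (j : ℕ) (hj : j < n) : (A ^ j) *ᵥ e ∈ V := by
    rw [← hrange]
    exact ⟨Pi.single ⟨j, hj⟩ 1, col_eq ⟨j, hj⟩⟩
  have pow_mem (j : ℕ) : j < n → (A ^ j) *ᵥ e ∈ V.map T ⊔ F ∙ e := by
    induction j with
    | zero =>
      intro _
      simpa using Submodule.mem_sup_right (Submodule.mem_span_singleton_self e)
    | succ j ih =>
      intro hj
      have h : (A ^ (j + 1)) *ᵥ e = T ((A ^ j) *ᵥ e) + lam • ((A ^ j) *ᵥ e) := by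
        rw [T_apply, sub_add_cancel, mulVec_mulVec, pow_succ']
      rw [h]
      exact add_mem
        (Submodule.mem_sup_left (Submodule.mem_map_of_mem (pow_mem_V j (by omega))))
        (Submodule.smul_mem _ _ (ih (by omega)))
  have hle : V ≤ V.map T ⊔ F ∙ e := by
    refine hrange.symm.le.trans ?_
    rw [range_mulVecLin, Submodule.span_le]
    rintro _ ⟨j, rfl⟩
    have := pow_mem j j.2
    rw [← col_eq, mulVec_single_one] at this
    exact this
  let K : Submodule F (Fin n → F) := (LinearMap.ker (T.domRestrict V)).map V.subtype
  have hK : Module.finrank F K ≤ 1 := by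
    have h₁ := LinearMap.finrank_range_add_finrank_ker (T.domRestrict V)
    have h₂ := Submodule.finrank_mono hle
    have h₃ := Submodule.finrank_add_le_finrank_add_finrank (V.map T) (F ∙ e)
    have h₄ : Module.finrank F (F ∙ e) ≤ 1 := by
      simpa using finrank_span_le_card (R := F) {e}
    have h₅ : Module.finrank F K ≤ _ := Submodule.finrank_map_le _ _
    rw [LinearMap.range_domRestrict] at h₁
    omega
  have mem_K (v : Fin n → F) (hv : z ⬝ᵥ v = 0) (hAv : A *ᵥ v = lam • v) : v ∈ K := by
    refine ⟨⟨v, hv⟩, ?_, rfl⟩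
    change T v = 0
    rw [T_apply, hAv, sub_self]
  obtain ⟨v, hv⟩ := finrank_le_one_iff.mp hK
  obtain ⟨a, ha⟩ := hv ⟨z, mem_K z hzz hAz⟩
  obtain ⟨b, hb⟩ := hv ⟨y, mem_K y hzy hAy⟩
  replace ha : a • (v : Fin n → F) = z := congrArg Subtype.val ha
  replace hb : b • (v : Fin n → F) = y := congrArg Subtype.val hb
  have ha₀ : a ≠ 0 := by
    rintro rfl
    exact hz (by rw [← ha, zero_smul])
  exact ⟨b * a⁻¹, by rw [← ha, ← hb, smul_smul, inv_mul_cancel_right₀ ha₀]⟩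

/-- Rows over `R` whose images under a surjective local homomorphism to a field are linearly
independent extend to an invertible square matrix. -/
theorem exists_isUnit_det_extending_rows {R F : Type*} [CommRing R] [Field F] (f : R →+* F)
    [IsLocalHom f] (hf : Function.Surjective f) {r m : ℕ} (hr : r ≤ m) (v : Fin r → Fin m → R)
    (hv : LinearIndependent F fun i => f ∘ v i) :
    ∃ N : Matrix (Fin m) (Fin m) R, IsUnit N.det ∧ ∀ i, N (Fin.castLE hr i) = v i := by
  have extend (s : ℕ) (hrs : r ≤ s) : s ≤ m → ∃ w : Fin s → Fin m → R,
      (LinearIndependent F fun i => f ∘ w i) ∧ ∀ i, w (Fin.castLE hrs i) = v i := by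
    induction s, hrs using Nat.le_induction with
    | base => exact fun _ => ⟨v, hv, fun _ => rfl⟩
    | succ s hrs ih =>
      intro hs
      obtain ⟨w, hw, hwv⟩ := ih (by omega)
      obtain ⟨x, hx⟩ := exists_linearIndependent_snoc_of_lt_finrank hw
        (by rw [Module.finrank_fin_fun]; omega)
      obtain ⟨x, rfl⟩ := hf.comp_left x
      refine ⟨Fin.snoc w x, ?_, fun i => ?_⟩
      · have h : (fun i => f ∘ (Fin.snoc w x : Fin (s + 1) → Fin m → R) i) =
            Fin.snoc (fun i => f ∘ w i) (f ∘ x) := by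
          ext i : 1
          refine Fin.lastCases ?_ (fun i => ?_) i <;> simp
        rw [h]
        exact hx
      · rw [← hwv i]
        exact Fin.snoc_castSucc (α := fun _ => Fin m → R) x w (Fin.castLE hrs i)
  obtain ⟨N, hN, hNv⟩ := extend m hr le_rfl
  refine ⟨of N, isUnit_of_map_unit f _ ?_, hNv⟩
  rw [RingHom.map_det, ← isUnit_iff_isUnit_det]
  exact linearIndependent_rows_iff_isUnit.mp hN

/-- A vector that does not vanish in the residue field is the last row of an invertible matrix. -/
theorem exists_isUnit_det_last_row {R F : Type*} [CommRing R] [Field F] (f : R →+* F)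
    [IsLocalHom f] (hf : Function.Surjective f) {k : ℕ} (z : Fin (k + 1) → R)
    (hz : f ∘ z ≠ 0) :
    ∃ U : Matrix (Fin (k + 1)) (Fin (k + 1)) R, IsUnit U.det ∧ U (Fin.last k) = z := by
  obtain ⟨N, hN, hNz⟩ := exists_isUnit_det_extending_rows f hf (Nat.le_add_left 1 k)
    (fun _ => z) (linearIndependent_unique_iff.mpr hz)
  refine ⟨N.submatrix Fin.revPerm id, ?_, ?_⟩
  · rw [det_permute]
    exact ((Units.isUnit _).map (Int.castRingHom R)).mul hN
  · ext j
    simpa using congrFun (hNz 0) j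

/-- A `(k + 1) × m` matrix over `R` annihilated on the left by `z`, whose left kernel over the
residue field is the line through `z`, has Smith normal form `diag(1, …, 1, 0)`; the left
multiplier may be chosen with last row `z`. -/
theorem exists_mul_mul_eq_snfMat {R F : Type*} [CommRing R] [Field F] (f : R →+* F)
    [IsLocalHom f] (hf : Function.Surjective f) {k m : ℕ} (hkm : k ≤ m)
    (M : Matrix (Fin (k + 1)) (Fin m) R) (z : Fin (k + 1) → R) (hz : f ∘ z ≠ 0)
    (hzM : z ᵥ* M = 0) (hker : ∀ y, y ᵥ* M.map f = 0 → ∃ a : F, y = a • (f ∘ z)) :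
    ∃ (U : Matrix (Fin (k + 1)) (Fin (k + 1)) R) (V : Matrix (Fin m) (Fin m) R),
      IsUnit U.det ∧ IsUnit V.det ∧ U * M * V = snfMat (k + 1) m k (fun _ => 1) ∧
        U (Fin.last k) = z := by
  obtain ⟨U, hU, hUz⟩ := exists_isUnit_det_last_row f hf z hz
  have hUF : IsUnit (U.map f) := by
    rw [isUnit_iff_isUnit_det]
    have := hU.map f
    rwa [RingHom.map_det] at this
  have hli : LinearIndependent F fun i : Fin k => f ∘ (U * M) i.castSucc := by
    rw [Fintype.linearIndependent_iff]
    intro c hc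
    have hcM : (Fin.snoc c 0 : Fin (k + 1) → F) ᵥ* U.map f ᵥ* M.map f = 0 := by
      rw [vecMul_vecMul, ← Matrix.map_mul, vecMul_eq_sum, Fin.sum_univ_castSucc]
      simp only [Fin.snoc_castSucc, Fin.snoc_last, zero_smul, add_zero]
      exact hc
    obtain ⟨a, ha⟩ := hker _ hcM
    have ha' : a • (f ∘ z) = Pi.single (Fin.last k) a ᵥ* U.map f := by
      rw [single_vecMul, ← hUz]
      rfl
    have hca := vecMul_injective_iff_isUnit.mpr hUF (ha.trans ha')
    intro i
    simpa using congrFun hca i.castSucc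
  obtain ⟨N, hN, hNU⟩ := exists_isUnit_det_extending_rows f hf hkm
    (fun i : Fin k => (U * M) i.castSucc) hli
  refine ⟨U, N⁻¹, hU, (isUnit_nonsing_inv_det_iff).mpr hN, ?_, hUz⟩
  suffices h : U * M = snfMat (k + 1) m k (fun _ => (1 : R)) * N by
    rw [h, mul_nonsing_inv_cancel_right _ _ hN]
  ext i j
  refine Fin.lastCases ?_ (fun i => ?_) i
  · have h : (U * M) (Fin.last k) = 0 := by
      rw [← hzM, ← hUz]
      rfl
    rw [h, mul_apply]
    simp [snfMat]
  · rw [← hNU i]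
    have h (l : Fin m) : snfMat (k + 1) m k (fun _ => (1 : R)) i.castSucc l =
        if Fin.castLE hkm i = l then 1 else 0 := by
      simp [snfMat, Fin.ext_iff]
    simp [mul_apply, h]

/-- If `U * M * V = diag(1, …, 1, 0)`, the column span of `M` contains every vector orthogonal to
the last row of `U`. -/
theorem exists_mulVec_eq_of_mul_mul_eq_snfMat {R : Type*} [CommRing R] {k m : ℕ} (hkm : k ≤ m)
    {M : Matrix (Fin (k + 1)) (Fin m) R} {U : Matrix (Fin (k + 1)) (Fin (k + 1)) R}
    {V : Matrix (Fin m) (Fin m) R} (hU : IsUnit U.det)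
    (h : U * M * V = snfMat (k + 1) m k (fun _ => 1)) (w : Fin (k + 1) → R)
    (hw : U (Fin.last k) ⬝ᵥ w = 0) : ∃ c, M *ᵥ c = w := by
  let d : Fin m → R := fun j => if hj : (j : ℕ) < k then (U *ᵥ w) ⟨j, by omega⟩ else 0
  refine ⟨V *ᵥ d, mulVec_injective_of_isUnit ((isUnit_iff_isUnit_det U).mpr hU) ?_⟩
  simp only [mulVec_mulVec]
  rw [← Matrix.mul_assoc, h]
  ext i
  refine Fin.lastCases ?_ (fun i => ?_) i
  · rw [show (U *ᵥ w) (Fin.last k) = 0 from hw]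
    simp [mulVec, dotProduct, snfMat]
  · have h (l : Fin m) : snfMat (k + 1) m k (fun _ => (1 : R)) i.castSucc l =
        if Fin.castLE hkm i = l then 1 else 0 := by
      simp [snfMat, Fin.ext_iff]
    simp only [mulVec, dotProduct, h, ite_mul, one_mul, zero_mul, Finset.sum_ite_eq,
      Finset.mem_univ, if_true]
    simp [d, mulVec, dotProduct, Fin.castSucc, Fin.castAdd, Fin.castLE]

/-- Reduction `ℤ/p^τ → ℤ/p` reflects units. -/
theorem ZMod.isLocalHom_castHom_prime_pow {p τ : ℕ} (hτ : p ∣ p ^ τ) :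
    IsLocalHom (ZMod.castHom hτ (ZMod p)) where
  map_nonunit a ha := by
    obtain ⟨a, rfl⟩ := ZMod.intCast_surjective a
    rw [map_intCast, ZMod.coe_int_isUnit_iff_isCoprime] at ha
    rw [ZMod.coe_int_isUnit_iff_isCoprime, Nat.cast_pow]
    exact ha.pow_left

theorem walkMatrix_map {R S : Type*} [CommRing R] [CommRing S] (f : R →+* S) {n : ℕ}
    (A : Matrix (Fin n) (Fin n) R) : (walkMatrix A).map f = walkMatrix (A.map f) := by
  ext i j
  have h : (A.map f) ^ (j : ℕ) = (A ^ (j : ℕ)).map f := (map_pow f.mapMatrix A j).symm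
  simp [walkMatrix, h, mulVec, dotProduct]

/-- The Smith normal form over `ℤ/p^τℤ` of the `n × (n+1)` matrix
`M = [A - λ₀ I, z₀]` is `[diag(1,…,1,0), 0]` (with `n-1` unit invariant
factors), and every integer vector `z` with `z₀ᵀ z ≡ 0 (mod p^τ)` is a
`ℤ/p^τℤ`-linear combination of the columns of `M`. -/
theorem augmented_matrix_snf_and_column_span
    {n : ℕ} (p : ℕ) (hp : p.Prime) (hodd : Odd p) (τ : ℕ) (hτ : 1 ≤ τ)
    (A : Matrix (Fin n) (Fin n) ℤ) (hsymm : Aᵀ = A)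
    (W : Matrix (Fin n) (Fin n) ℤ) (hW : W = walkMatrix A)
    (hrank : (W.map (Int.cast : ℤ → ZMod p)).rank = n - 1)
    (lam : ℤ) (z₀ : Fin n → ℤ) (hz₀p : ¬ (∀ i, (p : ℤ) ∣ z₀ i))
    (hAz₀ : ∀ i, (p : ℤ) ^ τ ∣ ((A - lam • (1 : Matrix (Fin n) (Fin n) ℤ)) *ᵥ z₀) i)
    (hz₀z₀ : (p : ℤ) ^ τ ∣ z₀ ⬝ᵥ z₀)
    (hWz₀ : ∀ i, (p : ℤ) ^ τ ∣ (Wᵀ *ᵥ z₀) i)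
    (Maug : Matrix (Fin n) (Fin (n + 1)) (ZMod (p ^ τ)))
    (hMaug : Maug = Matrix.of fun i jj =>
      Fin.lastCases ((z₀ i : ZMod (p ^ τ)))
        (fun j' => (((A - lam • (1 : Matrix (Fin n) (Fin n) ℤ)) i j' : ℤ) : ZMod (p ^ τ))) jj) :
    (∃ (U : Matrix (Fin n) (Fin n) (ZMod (p ^ τ)))
        (V : Matrix (Fin (n + 1)) (Fin (n + 1)) (ZMod (p ^ τ))),
      IsUnit U.det ∧ IsUnit V.det ∧
      U * Maug * V = snfMat n (n + 1) (n - 1) (fun _ => (1 : ZMod (p ^ τ)))) ∧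
    ∀ z : Fin n → ℤ, (p : ℤ) ^ τ ∣ z₀ ⬝ᵥ z →
      ∃ cvec : Fin (n + 1) → ZMod (p ^ τ),
        Maug *ᵥ cvec = fun i => ((z i : ZMod (p ^ τ))) := by
  subst hW
  have hτ₀ : τ ≠ 0 := by omega
  have := Fact.mk hp
  have hdvd : p ∣ p ^ τ := dvd_pow_self p hτ₀
  set f := ZMod.castHom hdvd (ZMod p) with hf
  have : IsLocalHom f := ZMod.isLocalHom_castHom_prime_pow hdvd
  have hfs : Function.Surjective f := ZMod.castHom_surjective hdvd
  obtain _ | k := n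
  · exact absurd (fun i => i.elim0) hz₀p
  set B := A - lam • (1 : Matrix (Fin (k + 1)) (Fin (k + 1)) ℤ) with hB
  have cast_eq_zero (a : ℤ) : (a : ZMod (p ^ τ)) = 0 ↔ (p : ℤ) ^ τ ∣ a := by
    rw [ZMod.intCast_zmod_eq_zero_iff_dvd, Nat.cast_pow]
  have cast_eq_zero' (a : ℤ) (ha : (p : ℤ) ^ τ ∣ a) : (a : ZMod p) = 0 :=
    (ZMod.intCast_zmod_eq_zero_iff_dvd a p).mpr ((dvd_pow_self _ hτ₀).trans ha)
  let z : Fin (k + 1) → ZMod (p ^ τ) := fun i => z₀ i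
  have hfz : f ∘ z = fun i => (z₀ i : ZMod p) := by
    ext i
    simp [z]
  have hz : f ∘ z ≠ 0 := by
    rw [hfz]
    exact fun h => hz₀p fun i => (ZMod.intCast_zmod_eq_zero_iff_dvd _ p).mp (congrFun h i)
  have hBsymm : Bᵀ = B := by simp [hB, hsymm]
  have hzM : z ᵥ* Maug = 0 := by
    rw [hMaug]
    ext j
    refine Fin.lastCases ?_ (fun j => ?_) j
    · simpa [z, vecMul, dotProduct] using (cast_eq_zero _).mpr hz₀z₀
    · have h := (cast_eq_zero _).mpr (hAz₀ j)
      rw [← hBsymm, mulVec_transpose] at h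
      simpa [z, vecMul, dotProduct] using h
  have eigen (y : Fin (k + 1) → ZMod p) (hy : B.map (Int.castRingHom (ZMod p)) *ᵥ y = 0) :
      A.map (Int.castRingHom (ZMod p)) *ᵥ y = (lam : ZMod p) • y := by
    have h : B.map (Int.castRingHom (ZMod p)) =
        A.map (Int.castRingHom (ZMod p)) - (lam : ZMod p) • 1 := by
      ext i j
      simp only [hB, map_apply, Matrix.sub_apply, Matrix.smul_apply, one_apply]
      split_ifs <;> simp
    rwa [h, sub_mulVec, smul_mulVec, one_mulVec, sub_eq_zero] at hy
  have hker (y : Fin (k + 1) → ZMod p) (hy : y ᵥ* Maug.map f = 0) :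
      ∃ a : ZMod p, y = a • (f ∘ z) := by
    apply walkMatrix_eigenvector_orthogonal_eq_smul (A.map (Int.castRingHom (ZMod p)))
      (lam := (lam : ZMod p)) (hz := hz)
    · rw [← walkMatrix_map]
      exact hrank
    · apply eigen
      ext i
      simpa [mulVec, dotProduct, z] using cast_eq_zero' _ (hAz₀ i)
    · simpa [dotProduct, z] using cast_eq_zero' _ hz₀z₀
    · rw [← walkMatrix_map]
      ext j
      have h := cast_eq_zero' _ (hWz₀ j)
      rw [mulVec_transpose] at h
      simpa [vecMul, dotProduct, z] using h
    · apply eigen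
      rw [← hBsymm, transpose_map, mulVec_transpose]
      ext j
      simpa [hMaug, vecMul, dotProduct] using congrFun hy j.castSucc
    · rw [dotProduct_comm, hfz]
      simpa [hMaug, vecMul, dotProduct] using congrFun hy (Fin.last _)
  obtain ⟨U, V, hU, hV, hUV, hUz⟩ :=
    exists_mul_mul_eq_snfMat f hfs (by omega) Maug z hz hzM hker
  refine ⟨⟨U, V, hU, hV, hUV⟩, fun w hw => ?_⟩
  refine exists_mulVec_eq_of_mul_mul_eq_snfMat (by omega) hU hUV _ ?_
  rw [hUz]
  simpa [z, dotProduct] using (cast_eq_zero _).mpr hw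
end

section
/- Let G be a controllable n-vertex graph and p an odd prime such that the walk matrix W(G) has rank n−1 over ℤ/pℤ. Then for every rational regular orthogonal matrix Q with Qᵀ A(G) Q a (0,1)-matrix, v_p(ℓ(Q)) ≤ (1/2) · v_p(det W(G)). Equivalently, v_p(L(G)) ≤ (1/2) v_p(det W(G)), where L(G) = lcm{ℓ(Q) : Q ∈ 𝒬(G)}. -/
open Matrix

open Classical in
/-- The adjacency matrix of a simple graph with entries in `R`. -/
noncomputable def adjMat {n : ℕ} (R : Type*) [Zero R] [One R]
    (G : SimpleGraph (Fin n)) : Matrix (Fin n) (Fin n) R :=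
  Matrix.of fun i j => if G.Adj i j then 1 else 0

/-- A rational matrix has integral entries. -/
def IsIntegralMat {n : ℕ} (M : Matrix (Fin n) (Fin n) ℚ) : Prop :=
  ∀ i j, ∃ z : ℤ, M i j = (z : ℚ)

/-- `ℓ` is the level of the rational matrix `Q`: the least positive integer
`k` such that `kQ` is integral. -/
def IsLevel {n : ℕ} (Q : Matrix (Fin n) (Fin n) ℚ) (ℓ : ℕ) : Prop :=
  0 < ℓ ∧ IsIntegralMat ((ℓ : ℚ) • Q) ∧
    ∀ k : ℕ, 0 < k → IsIntegralMat ((k : ℚ) • Q) → ℓ ≤ k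

/-- If `z ᵥ* N` vanishes modulo `q` and `z` has an entry that is a unit modulo `q`, then `q`
divides `det N`. -/
theorem dvd_det_of_dvd_vecMul {ι : Type*} [Fintype ι] [DecidableEq ι] {q : ℤ}
    (N : Matrix ι ι ℤ) (z : ι → ℤ) (i : ι) (hz : IsCoprime q (z i))
    (h : ∀ j, q ∣ (z ᵥ* N) j) : q ∣ N.det := by
  refine hz.dvd_of_dvd_mul_right (y := N.det) ?_
  have key : (z ᵥ* N) ᵥ* N.adjugate = N.det • z := by
    rw [Matrix.vecMul_vecMul, Matrix.mul_adjugate, Matrix.vecMul_smul, Matrix.vecMul_one]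
  have hi := congrFun key i
  rw [Pi.smul_apply, smul_eq_mul] at hi
  rw [← hi]
  exact Finset.dvd_sum fun j _ => Dvd.dvd.mul_right (h j) _

/-- If `z ᵥ* N` and `z ⬝ᵥ v` vanish modulo `q` and `z` has an entry that is a unit modulo `q`,
then `adj(N) v` vanishes modulo `q`. -/
theorem dvd_adjugate_mulVec {ι : Type*} [Fintype ι] [DecidableEq ι] {q : ℤ}
    (N : Matrix ι ι ℤ) (z v : ι → ℤ) (i : ι) (hz : IsCoprime q (z i))
    (h : ∀ j, q ∣ (z ᵥ* N) j) (hv : q ∣ z ⬝ᵥ v) (l : ι) :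
    q ∣ (N.adjugate *ᵥ v) l := by
  rw [← Matrix.cramer_eq_adjugate_mulVec, Matrix.cramer_apply]
  refine dvd_det_of_dvd_vecMul _ z i hz fun j => ?_
  by_cases hj : j = l
  · subst hj
    simpa [Matrix.vecMul, dotProduct] using hv
  · simpa [Matrix.vecMul, dotProduct, Matrix.updateCol_apply, hj] using h j

/-- If `W` has rank at least `n - 1` modulo `p`, then a solution of `v ᵥ* W = 0` modulo `p ^ k`
vanishes modulo `p ^ k` as soon as it vanishes at a coordinate where some solution modulo `p`
does not. -/
theorem pow_dvd_of_rank_of_apply_eq_zero {n : ℕ} {p : ℕ} [Fact p.Prime]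
    (W : Matrix (Fin n) (Fin n) ℤ) (hrank : n - 1 ≤ (W.map (Int.cast : ℤ → ZMod p)).rank)
    (x : Fin n → ℤ) (hx : ∀ j, (p : ℤ) ∣ (x ᵥ* W) j) (i : Fin n) (hxi : ¬ (p : ℤ) ∣ x i)
    (k : ℕ) (v : Fin n → ℤ) (hv : ∀ j, (p : ℤ) ^ k ∣ (v ᵥ* W) j) (hvi : v i = 0) (l : Fin n) :
    (p : ℤ) ^ k ∣ v l := by
  set K := LinearMap.ker (W.map (Int.cast : ℤ → ZMod p))ᵀ.mulVecLin with hK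
  have mem : ∀ w : Fin n → ℤ, (∀ j, (p : ℤ) ∣ (w ᵥ* W) j) →
      (fun j => (w j : ZMod p)) ∈ K := by
    intro w hw
    rw [hK, LinearMap.mem_ker, Matrix.mulVecLin_apply, Matrix.mulVec_transpose]
    ext j
    have := (ZMod.intCast_zmod_eq_zero_iff_dvd _ p).2 (hw j)
    simpa [Matrix.vecMul, dotProduct] using this
  have hfin : Module.finrank (ZMod p) K ≤ 1 := by
    have h1 := LinearMap.finrank_range_add_finrank_ker
      (W.map (Int.cast : ℤ → ZMod p))ᵀ.mulVecLin
    rw [← Matrix.rank, Matrix.rank_transpose, Module.finrank_fin_fun, ← hK] at h1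
    omega
  have hx0 : (x i : ZMod p) ≠ 0 := by
    rwa [Ne, ZMod.intCast_zmod_eq_zero_iff_dvd]
  induction k generalizing v l with
  | zero => simp
  | succ k ih =>
    have hvp : ∀ l, (p : ℤ) ∣ v l := by
      intro l
      obtain ⟨g, hg⟩ := finrank_le_one_iff.1 hfin
      obtain ⟨c, hc⟩ := hg ⟨_, mem x hx⟩
      obtain ⟨d, hd⟩ := hg ⟨_, mem v fun j => (dvd_pow_self _ k.succ_ne_zero).trans (hv j)⟩
      have hc' : ∀ j, c * (g : Fin n → ZMod p) j = (x j : ZMod p) := fun j =>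
        congrFun (congrArg Subtype.val hc) j
      have hd' : ∀ j, d * (g : Fin n → ZMod p) j = (v j : ZMod p) := fun j =>
        congrFun (congrArg Subtype.val hd) j
      have hgi : (g : Fin n → ZMod p) i ≠ 0 := by
        intro h0
        exact hx0 (by rw [← hc' i, h0, mul_zero])
      have hd0 : d = 0 := by
        have := hd' i
        rw [hvi, Int.cast_zero] at this
        exact (mul_eq_zero.1 this).resolve_right hgi
      rw [← ZMod.intCast_zmod_eq_zero_iff_dvd, ← hd' l, hd0, zero_mul]
    choose w hw using hvp
    have hp0 : (p : ℤ) ≠ 0 := by exact_mod_cast (Fact.out : p.Prime).ne_zero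
    have hvw : v = (p : ℤ) • w := funext hw
    rw [hw l, pow_succ']
    refine mul_dvd_mul_left _ (ih w (fun j => ?_) ?_ l)
    · have := hv j
      rw [hvw, Matrix.smul_vecMul, Pi.smul_apply, smul_eq_mul, pow_succ'] at this
      exact (mul_dvd_mul_iff_left hp0).1 this
    · have := hw i
      rw [hvi] at this
      exact (mul_eq_zero.1 this.symm).resolve_left hp0

/-- For `a` not a root of the characteristic polynomial, `adj(a - A)` is a monic polynomial in `A`
of degree `n - 1`. -/
theorem exists_adjugate_eq_aeval {n : ℕ} (hn : n ≠ 0) (A : Matrix (Fin n) (Fin n) ℤ) (a : ℤ)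
    (ha : (Matrix.scalar (Fin n) a - A).det ≠ 0) :
    ∃ g : Polynomial ℤ, g.Monic ∧ g.natDegree = n - 1 ∧
      (Matrix.scalar (Fin n) a - A).adjugate = Polynomial.aeval A g := by
  open Polynomial in
  have : Nonempty (Fin n) := ⟨⟨0, Nat.pos_of_ne_zero hn⟩⟩
  have hdeg : A.charpoly.natDegree = n := by simp
  have hm := monic_X_sub_C a
  refine ⟨A.charpoly /ₘ (X - C a), ?_, ?_, ?_⟩
  · have h := leadingCoeff_divByMonic_of_monic hm (p := A.charpoly) ?_
    · rw [Monic, h, A.charpoly_monic]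
    · rw [degree_X_sub_C, A.charpoly_degree_eq_dim]
      rw [Fintype.card_fin]
      exact_mod_cast Nat.pos_of_ne_zero hn
  · rw [natDegree_divByMonic _ hm, hdeg, natDegree_X_sub_C]
  · set g := A.charpoly /ₘ (X - C a)
    set N := Matrix.scalar (Fin n) a - A
    have h1 : C (A.charpoly.eval a) + (X - C a) * g = A.charpoly := by
      rw [← modByMonic_X_sub_C_eq_C_eval]
      exact modByMonic_add_div _ _
    have h2 := congrArg (aeval A) h1
    rw [Matrix.aeval_self_charpoly] at h2
    have h3 : N * aeval A g = N.det • (1 : Matrix (Fin n) (Fin n) ℤ) := by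
      have hN : aeval A (X - C a) = -N := by
        simp [N]
      rw [map_add, map_mul, hN, aeval_C, Matrix.eval_charpoly, neg_mul, ← sub_eq_add_neg] at h2
      rw [← sub_eq_zero.1 h2, Algebra.algebraMap_eq_smul_one]
    have h4 : N.det • aeval A g = N.det • N.adjugate := by
      have := congrArg (N.adjugate * ·) h3
      rwa [← Matrix.mul_assoc, Matrix.adjugate_mul, Matrix.smul_mul, Matrix.one_mul,
        Matrix.mul_smul, Matrix.mul_one] at this
    exact (smul_right_injective _ ha h4).symm

/-- Replacing the last column of the walk matrix by `g(A) e`, with `g` monic of degree `n - 1`,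
does not change its determinant. -/
theorem det_updateCol_walkMatrix {n : ℕ} (A : Matrix (Fin n) (Fin n) ℤ) (g : Polynomial ℤ)
    (hg : g.Monic) (l : Fin n) (hl : (l : ℕ) = n - 1) (hdeg : g.natDegree = n - 1) :
    ((walkMatrix A).updateCol l (Polynomial.aeval A g *ᵥ fun _ => 1)).det =
      (walkMatrix A).det := by
  have h : (Polynomial.aeval A g *ᵥ fun _ => 1) =
      walkMatrix A *ᵥ fun j : Fin n => g.coeff j := by
    have hn : g.natDegree < n := by have := l.2; omega
    rw [Polynomial.aeval_eq_sum_range' hn, Matrix.sum_mulVec]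
    ext i
    rw [Finset.sum_apply, Finset.sum_range]
    simp [walkMatrix, Matrix.mulVec, dotProduct, mul_comm, Finset.sum_mul]
  rw [← Matrix.cramer_apply, h, Matrix.cramer_eq_adjugate_mulVec, Matrix.mulVec_mulVec,
    Matrix.adjugate_mul, Matrix.smul_mulVec, Matrix.one_mulVec, Pi.smul_apply, smul_eq_mul, hl,
    ← hdeg, hg.coeff_natDegree, mul_one]

/-- Every residue class contains an integer which is not an eigenvalue of `A`. -/
theorem exists_modEq_det_scalar_sub_ne_zero {n : ℕ} (A : Matrix (Fin n) (Fin n) ℤ) (q b : ℤ)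
    (hq : q ≠ 0) : ∃ a : ℤ, q ∣ a - b ∧ (Matrix.scalar (Fin n) a - A).det ≠ 0 := by
  by_contra! h
  refine A.charpoly_monic.ne_zero (Polynomial.eq_zero_of_infinite_isRoot _ ?_)
  refine (Set.infinite_range_of_injective (f := fun t : ℤ => b + q * t) ?_).mono ?_
  · intro s t hst
    simpa [hq] using hst
  · rintro _ ⟨t, rfl⟩
    rw [Set.mem_ofPred_eq, Polynomial.IsRoot.def, Matrix.eval_charpoly]
    exact h _ ⟨t, by ring⟩

/-- If `M` intertwines `A` and `B`, then it intertwines their powers. -/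
theorem pow_mul_eq_mul_pow {n : ℕ} {A B M : Matrix (Fin n) (Fin n) ℤ} (h : A * M = M * B) (j : ℕ) :
    A ^ j * M = M * B ^ j :=
  (SemiconjBy.pow_right (show SemiconjBy M B A from h.symm) j).symm

/-- If an integral matrix `M` with constant row and column sums `ℓ` intertwines symmetric matrices
`A` and `B`, and has an entry prime to `p`, then `p ^ k ∣ ℓ` forces `p ^ (2 * k)` to divide the
determinant of the walk matrix of `A`, provided this matrix has corank at most one modulo `p`. -/
theorem sq_dvd_det_walkMatrix {n : ℕ} {p : ℕ} [Fact p.Prime] {k : ℕ} (hk : k ≠ 0)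
    (A B M : Matrix (Fin n) (Fin n) ℤ) (ℓ : ℤ) (hA : Aᵀ = A) (hB : Bᵀ = B)
    (hAM : A * M = M * B) (hM1 : M *ᵥ (fun _ => 1) = fun _ => ℓ)
    (h1M : (fun _ => 1) ᵥ* M = fun _ => ℓ) (hMdet : M.det ≠ 0) (hℓ : (p : ℤ) ^ k ∣ ℓ)
    (i₀ j₀ : Fin n) (hM : ¬ (p : ℤ) ∣ M i₀ j₀)
    (hrank : n - 1 ≤ ((walkMatrix A).map (Int.cast : ℤ → ZMod p)).rank) :
    ((p : ℤ) ^ k) * (p : ℤ) ^ k ∣ (walkMatrix A).det := by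
  have hn : n ≠ 0 := fun h => by subst h; exact i₀.elim0
  have hpp : Prime (p : ℤ) := Nat.prime_iff_prime_int.1 Fact.out
  have hcop : IsCoprime ((p : ℤ) ^ k) (M i₀ j₀) :=
    ((hpp.coprime_iff_not_dvd).2 hM).pow_left
  set q : ℤ := (p : ℤ) ^ k with hq
  have hq0 : q ≠ 0 := pow_ne_zero _ hpp.ne_zero
  have hpq : (p : ℤ) ∣ q := dvd_pow_self _ hk
  -- the columns of `M` are orthogonal to the walk matrix modulo `q`
  have hcol : ∀ j l, (M.col j ᵥ* walkMatrix A) l = ℓ * ((fun _ => 1) ᵥ* B ^ (l : ℕ)) j := by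
    intro j l
    have e1 : (M.col j ᵥ* walkMatrix A) l = ((A ^ (l : ℕ) *ᵥ fun _ => 1) ᵥ* M) j := by
      simp [Matrix.vecMul, dotProduct, walkMatrix, Matrix.col, mul_comm]
    have e2 : (A ^ (l : ℕ) *ᵥ fun _ => (1 : ℤ)) = (fun _ => 1) ᵥ* A ^ (l : ℕ) := by
      rw [← Matrix.mulVec_transpose, Matrix.transpose_pow, hA]
    have e3 : (fun _ : Fin n => ℓ) = ℓ • fun _ => (1 : ℤ) := by ext; simp
    rw [e1, e2, Matrix.vecMul_vecMul, pow_mul_eq_mul_pow hAM, ← Matrix.vecMul_vecMul, h1M, e3,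
      Matrix.smul_vecMul, Pi.smul_apply, smul_eq_mul]
  have hcolq : ∀ j l, q ∣ (M.col j ᵥ* walkMatrix A) l := fun j l => by
    rw [hcol]; exact hℓ.mul_right _
  -- `M` has rank one modulo `q`
  have hminor : ∀ i j, q ∣ M i₀ j₀ * M i j - M i₀ j * M i j₀ := by
    intro i j
    refine pow_dvd_of_rank_of_apply_eq_zero (walkMatrix A) hrank (M.col j₀)
      (fun l => hpq.trans (hcolq j₀ l)) i₀ hM k
      (M i₀ j₀ • M.col j - M i₀ j • M.col j₀) (fun l => ?_) ?_ i
    · rw [Matrix.sub_vecMul, Matrix.smul_vecMul, Matrix.smul_vecMul]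
      exact dvd_sub ((hcolq j l).mul_left _) ((hcolq j₀ l).mul_left _)
    · simp [Matrix.col]; ring
  obtain ⟨s, c, hsc⟩ := hcop
  obtain ⟨a, hab, ha⟩ := exists_modEq_det_scalar_sub_ne_zero A q (c * (A * M) i₀ j₀) hq0
  -- column `j₀` and row `i₀` of `M` are eigenvectors modulo `q`, for the same eigenvalue
  have hminor' : ∀ i j, q ∣ M i j - c * (M i₀ j * M i j₀) := by
    intro i j
    have : M i j - c * (M i₀ j * M i j₀) =
        q * (s * M i j) + c * (M i₀ j₀ * M i j - M i₀ j * M i j₀) := by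
      linear_combination (-M i j) * hsc
    rw [this]
    exact dvd_add (dvd_mul_right _ _) ((hminor i j).mul_left _)
  have heigA : ∀ i, q ∣ (M.col j₀ ᵥ* (Matrix.scalar (Fin n) a - A)) i := by
    intro i
    have e1 : (M.col j₀ ᵥ* (Matrix.scalar (Fin n) a - A)) i = a * M i j₀ - (M * B) i j₀ := by
      rw [Matrix.vecMul_sub, ← hAM, Pi.sub_apply]
      congr 1
      · simp [Matrix.col, mul_comm]
      · nth_rewrite 1 [← hA]
        simp [Matrix.vecMul_transpose, Matrix.mulVec, Matrix.mul_apply, dotProduct, Matrix.col]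
    have e2 : q ∣ (M * B) i j₀ - c * (M * B) i₀ j₀ * M i j₀ := by
      have : (M * B) i j₀ - c * (M * B) i₀ j₀ * M i j₀ =
          ∑ l, (M i l - c * (M i₀ l * M i j₀)) * B l j₀ := by
        simp only [Matrix.mul_apply, sub_mul, Finset.sum_sub_distrib, Finset.mul_sum,
          Finset.sum_mul]
        congr 1
        exact Finset.sum_congr rfl fun l _ => by ring
      rw [this]
      exact Finset.dvd_sum fun l _ => (hminor' i l).mul_right _
    rw [hAM] at hab
    have := dvd_sub (hab.mul_right (M i j₀)) e2
    have e3 : a * M i j₀ - (M * B) i j₀ = (a - c * (M * B) i₀ j₀) * M i j₀ -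
        ((M * B) i j₀ - c * (M * B) i₀ j₀ * M i j₀) := by ring
    rwa [e1, e3]
  have heigB : ∀ j, q ∣ (M.row i₀ ᵥ* (Matrix.scalar (Fin n) a - B)) j := by
    intro j
    have e1 : (M.row i₀ ᵥ* (Matrix.scalar (Fin n) a - B)) j = a * M i₀ j - (A * M) i₀ j := by
      rw [Matrix.vecMul_sub, hAM, Pi.sub_apply]
      congr 1
      simp [Matrix.row, mul_comm]
    have e2 : q ∣ (A * M) i₀ j - c * (A * M) i₀ j₀ * M i₀ j := by
      have : (A * M) i₀ j - c * (A * M) i₀ j₀ * M i₀ j =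
          ∑ l, A i₀ l * (M l j - c * (M i₀ j * M l j₀)) := by
        simp only [Matrix.mul_apply, mul_sub, Finset.sum_sub_distrib, Finset.mul_sum,
          Finset.sum_mul]
        congr 1
        exact Finset.sum_congr rfl fun l _ => by ring
      rw [this]
      exact Finset.dvd_sum fun l _ => (hminor' l j).mul_left _
    have := dvd_sub (hab.mul_right (M i₀ j)) e2
    have e3 : a * M i₀ j - (A * M) i₀ j = (a - c * (A * M) i₀ j₀) * M i₀ j -
        ((A * M) i₀ j - c * (A * M) i₀ j₀ * M i₀ j) := by ring
    rwa [e1, e3]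
  have hcop : IsCoprime q (M i₀ j₀) := ⟨s, c, hsc⟩
  set NA := Matrix.scalar (Fin n) a - A with hNA
  set NB := Matrix.scalar (Fin n) a - B with hNB
  have hu := dvd_adjugate_mulVec NA (M.col j₀) (fun _ => 1) i₀ hcop heigA (by
    have := congrFun h1M j₀
    rw [dotProduct_comm]
    exact (show (fun _ => (1 : ℤ)) ⬝ᵥ M.col j₀ = ℓ from this) ▸ hℓ)
  have hu' := dvd_adjugate_mulVec NB (M.row i₀) (fun _ => 1) j₀ hcop heigB (by
    have := congrFun hM1 i₀
    exact (show M.row i₀ ⬝ᵥ (fun _ => (1 : ℤ)) = ℓ from this) ▸ hℓ)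
  choose u hu using hu
  choose u' hu' using hu'
  have hNM : NA * M = M * NB := by
    rw [hNA, hNB, Matrix.sub_mul, Matrix.mul_sub, hAM, Matrix.scalar_comm]
    exact fun r => Commute.all _ _
  have hdet : NA.det = NB.det := by
    have := congrArg Matrix.det hNM
    rw [Matrix.det_mul, Matrix.det_mul, mul_comm] at this
    exact mul_left_cancel₀ hMdet this
  have hadj : NA.adjugate * M = M * NB.adjugate := by
    refine smul_right_injective _ ha ?_
    have := congrArg (fun X => NA.adjugate * X * NB.adjugate) hNM
    simp only [← Matrix.mul_assoc, Matrix.adjugate_mul] at this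
    simp only [Matrix.mul_assoc, Matrix.mul_adjugate, Matrix.smul_mul, Matrix.mul_smul,
      Matrix.one_mul, Matrix.mul_one, ← hdet] at this
    exact this.symm
  have hNAt : NA.adjugateᵀ = NA.adjugate := by
    rw [Matrix.adjugate_transpose, hNA, Matrix.transpose_sub, hA]; simp
  have hNBt : NB.adjugateᵀ = NB.adjugate := by
    rw [Matrix.adjugate_transpose, hNB, Matrix.transpose_sub, hB]; simp
  -- `u ᵥ* M = ℓ u'`
  have hsu : NA.adjugate *ᵥ (fun _ => 1) = q • u := funext hu
  have hsu' : NB.adjugate *ᵥ (fun _ => 1) = q • u' := funext hu'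
  have huM : u ᵥ* M = ℓ • u' := by
    refine smul_right_injective _ hq0 ?_
    have e3 : (fun _ : Fin n => ℓ) = ℓ • fun _ => (1 : ℤ) := by ext; simp
    simp only
    rw [← Matrix.smul_vecMul, ← hsu, ← Matrix.vecMul_transpose, hNAt, Matrix.vecMul_vecMul, hadj,
      ← Matrix.vecMul_vecMul, h1M, e3, Matrix.smul_vecMul, ← hNBt, Matrix.vecMul_transpose, hsu',
      smul_comm]
  obtain ⟨g, hgm, hgd, hgA⟩ := exists_adjugate_eq_aeval hn A a ha
  have hlast := det_updateCol_walkMatrix A g hgm ⟨n - 1, by omega⟩ rfl hgd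
  rw [← hgA, ← hNA, hsu, Matrix.det_updateCol_smul] at hlast
  rw [← hlast]
  refine mul_dvd_mul_left _ (dvd_det_of_dvd_vecMul _ (M.col j₀) i₀ hcop fun l => ?_)
  by_cases hl : l = ⟨n - 1, by omega⟩
  · subst hl
    have := congrFun huM j₀
    have e : (M.col j₀ ᵥ* (walkMatrix A).updateCol ⟨n - 1, by omega⟩ u) ⟨n - 1, by omega⟩ =
        (u ᵥ* M) j₀ := by
      simp [Matrix.vecMul, dotProduct, Matrix.col, mul_comm]
    rw [e, this]
    exact hℓ.mul_right _
  · simpa [Matrix.vecMul, dotProduct, Matrix.updateCol_apply, hl] using hcolq j₀ l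

/-- Main theorem: if `G` is a controllable graph and `p` an odd prime such that
`W(G)` has rank `n-1` over `ℤ/pℤ`, then for every rational regular orthogonal
matrix `Q` with `Qᵀ A(G) Q` a `(0,1)`-matrix, `v_p(ℓ(Q)) ≤ ½ v_p(det W(G))`. -/
theorem vp_level_le_half_vp_det_walkMatrix
    {n : ℕ} (p : ℕ) (hp : p.Prime) (hodd : Odd p)
    (G : SimpleGraph (Fin n))
    (W : Matrix (Fin n) (Fin n) ℤ) (hW : W = walkMatrix (adjMat ℤ G))
    (hcontrol : W.det ≠ 0)
    (hrank : (W.map (Int.cast : ℤ → ZMod p)).rank = n - 1)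
    (Q : Matrix (Fin n) (Fin n) ℚ)
    (hQorth : Qᵀ * Q = 1) (hQreg : Q *ᵥ (fun _ => 1) = (fun _ => 1))
    (hQ01 : ∀ i j, (Qᵀ * adjMat ℚ G * Q) i j = 0 ∨ (Qᵀ * adjMat ℚ G * Q) i j = 1)
    (ℓ : ℕ) (hℓ : IsLevel Q ℓ) :
    2 * padicValNat p ℓ ≤ padicValInt p W.det := by
  have : Fact p.Prime := ⟨hp⟩
  obtain ⟨hℓ0, hint, hmin⟩ := hℓ
  by_cases hk : padicValNat p ℓ = 0
  · simp [hk]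
  have hpℓ : p ∣ ℓ := by
    by_contra h
    exact hk (padicValNat.eq_zero_of_not_dvd h)
  choose M hM using hint
  have hMQ : (Matrix.of M).map (Int.cast : ℤ → ℚ) = (ℓ : ℚ) • Q := by
    ext i j; simpa using (hM i j).symm
  have hexists : ∃ i j, ¬ (p : ℤ) ∣ M i j := by
    by_contra! h
    obtain ⟨r, rfl⟩ := hpℓ
    have hr : 0 < r := Nat.pos_of_mul_pos_left hℓ0
    have := hmin r hr fun i j => by
      obtain ⟨t, ht⟩ := h i j
      refine ⟨t, ?_⟩
      have h1 := hM i j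
      have hp0 : (p : ℚ) ≠ 0 := by exact_mod_cast hp.ne_zero
      rw [ht] at h1
      simp only [Matrix.smul_apply, smul_eq_mul] at h1 ⊢
      push_cast at h1
      exact mul_left_cancel₀ hp0 (by rw [← h1]; ring)
    have := hp.two_le
    nlinarith
  obtain ⟨i₀, j₀, hij⟩ := hexists
  have hB : ∀ i j, ∃ z : ℤ, (Qᵀ * adjMat ℚ G * Q) i j = z := fun i j =>
    (hQ01 i j).elim (fun h => ⟨0, by simpa using h⟩) fun h => ⟨1, by simpa using h⟩
  choose B hB using hB
  have hBQ : (Matrix.of B).map (Int.cast : ℤ → ℚ) = Qᵀ * adjMat ℚ G * Q := by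
    ext i j; exact (hB i j).symm
  have hAQ : (adjMat ℤ G).map (Int.cast : ℤ → ℚ) = adjMat ℚ G := by
    ext i j; simp [adjMat, apply_ite (Int.cast : ℤ → ℚ)]
  have hAt : ∀ (R : Type) [Zero R] [One R], (adjMat R G)ᵀ = adjMat R G := by
    intro R _ _
    ext i j
    by_cases h : G.Adj i j <;> simp [adjMat, h, G.adj_comm j i]
  have hinj : Function.Injective
      (fun X : Matrix (Fin n) (Fin n) ℤ => X.map (Int.cast : ℤ → ℚ)) :=
    Matrix.map_injective Int.cast_injective
  have hmul : ∀ X Y : Matrix (Fin n) (Fin n) ℤ, (X * Y).map (Int.cast : ℤ → ℚ) =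
      X.map (Int.cast : ℤ → ℚ) * Y.map (Int.cast : ℤ → ℚ) := fun X Y =>
    Matrix.map_mul (f := Int.castRingHom ℚ)
  have hQQ : Q * Qᵀ = 1 := mul_eq_one_comm.1 hQorth
  have hQreg' : (fun _ => (1 : ℚ)) ᵥ* Q = fun _ => 1 := by
    rw [← Matrix.mulVec_transpose]
    nth_rewrite 1 [← hQreg]
    rw [Matrix.mulVec_mulVec, hQorth, Matrix.one_mulVec]
  have hdvd := sq_dvd_det_walkMatrix (p := p) hk (adjMat ℤ G) (Matrix.of B) (Matrix.of M) ℓ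
    (hAt ℤ) ?_ ?_ ?_ ?_ ?_ (by exact_mod_cast pow_padicValNat_dvd) i₀ j₀ hij
    (by rw [← hW]; exact hrank.ge)
  · rw [← hW, ← pow_add, ← two_mul] at hdvd
    rw [padicValInt]
    refine (padicValNat_dvd_iff_le (by simpa using hcontrol)).1 ?_
    have := Int.natAbs_dvd_natAbs.2 hdvd
    simpa [Int.natAbs_pow] using this
  · apply hinj
    simp only
    rw [Matrix.transpose_map, hBQ, Matrix.transpose_mul, Matrix.transpose_mul, hAt ℚ,
      Matrix.transpose_transpose, Matrix.mul_assoc]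
  · apply hinj
    simp only
    rw [hmul, hmul, hMQ, hBQ, hAQ, Matrix.smul_mul, Matrix.mul_smul, ← Matrix.mul_assoc,
      ← Matrix.mul_assoc, hQQ, Matrix.one_mul]
  · ext i
    have := congrFun hQreg i
    simp only [Matrix.mulVec, dotProduct, Matrix.of_apply, mul_one] at this ⊢
    have h2 : ((∑ j, M i j : ℤ) : ℚ) = ℓ := by
      rw [Int.cast_sum]
      simp only [← hM, Matrix.smul_apply, smul_eq_mul, ← Finset.mul_sum, this, mul_one]
    exact_mod_cast h2
  · ext j
    have := congrFun hQreg' j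
    simp only [Matrix.vecMul, dotProduct, Matrix.of_apply, one_mul] at this ⊢
    have h2 : ((∑ i, M i j : ℤ) : ℚ) = ℓ := by
      rw [Int.cast_sum]
      simp only [← hM, Matrix.smul_apply, smul_eq_mul, ← Finset.mul_sum, this, mul_one]
    exact_mod_cast h2
  · intro h0
    have h1 : (((Matrix.of M).det : ℤ) : ℚ) = ((ℓ : ℚ) • Q).det := by
      rw [← hMQ]; exact (Int.castRingHom ℚ).map_det _
    rw [h0, Int.cast_zero, Matrix.det_smul] at h1
    have h2 : Q.det * Q.det = 1 := by
      simpa using congrArg Matrix.det hQQ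
    have h3 : (ℓ : ℚ) ≠ 0 := by exact_mod_cast hℓ0.ne'
    have h4 := (mul_eq_zero.1 h1.symm).resolve_left (pow_ne_zero _ h3)
    rw [h4, mul_zero] at h2
    exact zero_ne_one h2
end

section
/- Let G be a controllable graph and suppose the invariant factors d_1, …, d_n of W(G) satisfy d_{⌈n/2⌉} = 1 and d_{n−1} = 2, with d_n = 2^{m_1} · p_2^{m_2} ⋯ p_k^{m_k} (p_2, …, p_k distinct odd primes). If v_p(L(G)) ≤ ⌊m_i/2⌋ for each odd prime p_i and v_2(L(G)) ≤ m_1 − 1, and each achievable level corresponds to at most one graph, then G has at most m_1 · ∏_{i=2}^{k}(⌊m_i/2⌋ + 1) − 1 generalized cospectral mates. -/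
open Matrix

/-- Membership in `𝒬(G)`: `Q` is a rational regular orthogonal matrix such
that `Qᵀ A(G) Q` is a `(0,1)`-matrix. -/
def MemQSet {n : ℕ} (G : SimpleGraph (Fin n)) (Q : Matrix (Fin n) (Fin n) ℚ) : Prop :=
  Qᵀ * Q = 1 ∧ Q *ᵥ (fun _ => 1) = (fun _ => 1) ∧
    ∀ i j, (Qᵀ * adjMat ℚ G * Q) i j = 0 ∨ (Qᵀ * adjMat ℚ G * Q) i j = 1

/-- `G` and `H` are generalized cospectral. -/
def GenCospectral {n : ℕ} (G H : SimpleGraph (Fin n)) : Prop :=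
  (adjMat ℚ G).charpoly = (adjMat ℚ H).charpoly ∧
    (adjMat ℚ Gᶜ).charpoly = (adjMat ℚ Hᶜ).charpoly

open Polynomial in
/-- The numerator `eᵀ adj(xI - A) Aᵏ e` of the resolvent entry `eᵀ (xI - A)⁻¹ Aᵏ e`. -/
noncomputable def resolventNumerator {n : ℕ} (A : Matrix (Fin n) (Fin n) ℚ) (k : ℕ) : ℚ[X] :=
  (fun _ => 1) ⬝ᵥ ((charmatrix A).adjugate *ᵥ fun i => C (((A ^ k) *ᵥ fun _ => 1) i))

open Polynomial in
theorem natDegree_adjugate_charmatrix_le {n : ℕ} (A : Matrix (Fin n) (Fin n) ℚ) (i j : Fin n) :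
    ((charmatrix A).adjugate i j).natDegree ≤ n - 1 := by
  rw [adjugate_apply, det_apply]
  refine natDegree_sum_le_of_forall_le _ _ fun σ _ => ?_
  refine (natDegree_smul_le _ _).trans ((natDegree_prod_le _ _).trans ?_)
  have h : ∀ l : Fin n, ((charmatrix A).updateRow j (Pi.single i 1) (σ l) l).natDegree ≤
      if l = σ.symm j then 0 else 1 := by
    intro l
    by_cases hl : σ l = j
    · have : l = σ.symm j := by rw [← hl, Equiv.symm_apply_apply]
      rw [if_pos this, hl, updateRow_self, Pi.single_apply]
      split_ifs <;> simp
    · have : l ≠ σ.symm j := fun h => hl (by rw [h, Equiv.apply_symm_apply])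
      rw [if_neg this, updateRow_ne hl, charmatrix_apply, diagonal_apply]
      split_ifs
      · exact (natDegree_X_sub_C _).le
      · simp
  refine (Finset.sum_le_sum fun l _ => h l).trans ?_
  simp [Finset.sum_ite, Finset.filter_ne']

open Polynomial in
theorem natDegree_resolventNumerator_le {n : ℕ} (A : Matrix (Fin n) (Fin n) ℚ) (k : ℕ) :
    (resolventNumerator A k).natDegree ≤ n - 1 := by
  unfold resolventNumerator dotProduct mulVec dotProduct
  refine natDegree_sum_le_of_forall_le _ _ fun i _ => ?_
  rw [one_mul]
  refine natDegree_sum_le_of_forall_le _ _ fun j _ => ?_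
  exact (natDegree_mul_C_le _ _).trans (natDegree_adjugate_charmatrix_le A i j)

open Polynomial in
theorem X_mul_resolventNumerator_sub {n : ℕ} (A : Matrix (Fin n) (Fin n) ℚ) (k : ℕ) :
    X * resolventNumerator A k - resolventNumerator A (k + 1) =
      A.charpoly * C ((fun _ => 1) ⬝ᵥ ((A ^ k) *ᵥ fun _ => 1)) := by
  set v : Fin n → ℚ[X] := fun i => C (((A ^ k) *ᵥ fun _ => 1) i) with hv
  have hstep : (fun i => C (((A ^ (k + 1)) *ᵥ fun _ => 1) i)) =
      (X : ℚ[X]) • v - charmatrix A *ᵥ v := by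
    rw [pow_succ', ← mulVec_mulVec]
    funext i
    simp only [charmatrix, RingHom.mapMatrix_apply, sub_mulVec, Pi.sub_apply, Pi.smul_apply,
      scalar_apply, mulVec_diagonal, smul_eq_mul, sub_sub_cancel, hv]
    simp [mulVec, dotProduct]
  unfold resolventNumerator
  rw [hstep, ← hv, mulVec_sub, dotProduct_sub, mulVec_smul, dotProduct_smul, smul_eq_mul,
    sub_sub_cancel, mulVec_mulVec, adjugate_mul, smul_mulVec, one_mulVec, dotProduct_smul,
    smul_eq_mul, charpoly]
  congr 1
  simp [dotProduct, hv]

open Polynomial in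
theorem eval_resolventNumerator_zero {n : ℕ} (A : Matrix (Fin n) (Fin n) ℚ) (s : ℚ) :
    (resolventNumerator A 0).eval s =
      (fun _ => 1) ⬝ᵥ ((scalar (Fin n) s - A).adjugate *ᵥ fun _ => 1) := by
  have h : (charmatrix A).map (evalRingHom s) = scalar (Fin n) s - A := by
    ext i j
    by_cases hij : i = j
    · subst hij; simp
    · simp [hij]
  have h2 := (RingHom.map_adjugate (evalRingHom s) (charmatrix A)).trans
    (congrArg adjugate h)
  rw [← h2]
  simp [resolventNumerator, dotProduct, mulVec, eval_finsetSum, one_apply]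

theorem adjMat_compl {n : ℕ} (G : SimpleGraph (Fin n)) :
    adjMat ℚ Gᶜ = vecMulVec (fun _ => 1) (fun _ => 1) - 1 - adjMat ℚ G := by
  ext i j
  by_cases hij : i = j
  · subst hij; simp [adjMat, vecMulVec]
  · by_cases h : G.Adj i j <;> simp [adjMat, vecMulVec, hij, h]

/-- The matrix determinant lemma relating the characteristic polynomial of the complement to the
resolvent. -/
theorem eval_charpoly_compl {n : ℕ} (G : SimpleGraph (Fin n)) (s : ℚ)
    (hs : (adjMat ℚ G).charpoly.eval s ≠ 0) :
    (adjMat ℚ Gᶜ).charpoly.eval (-s - 1) =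
      (-1) ^ n * ((adjMat ℚ G).charpoly.eval s + (resolventNumerator (adjMat ℚ G) 0).eval s) := by
  set A := adjMat ℚ G with hA
  have hM : scalar (Fin n) (-s - 1) - adjMat ℚ Gᶜ =
      -((scalar (Fin n) s - A) + replicateCol Unit (fun _ => (1 : ℚ)) *
        replicateRow Unit (fun _ => (1 : ℚ))) := by
    rw [adjMat_compl, ← hA]
    ext i j
    by_cases hij : i = j
    · subst hij; simp [vecMulVec, mul_apply]; ring
    · simp [vecMulVec, mul_apply, hij]; ring
  rw [eval_charpoly] at hs ⊢
  rw [hM, det_neg, Fintype.card_fin, det_add_replicateCol_mul_replicateRow (isUnit_iff_ne_zero.2 hs),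
    eval_charpoly, eval_resolventNumerator_zero]
  congr 1
  rw [inv_def, Ring.inverse_eq_inv', Matrix.mul_smul, Matrix.smul_mul,
    det_unique (n := Unit), Matrix.add_apply, one_apply_eq, Matrix.smul_apply, mul_add, mul_one, smul_eq_mul, mul_inv_cancel_left₀ hs]
  congr 1
  rw [Matrix.mul_assoc]
  rfl

open Polynomial in
theorem GenCospectral.resolventNumerator_zero_eq {n : ℕ} {G H : SimpleGraph (Fin n)}
    (h : GenCospectral G H) :
    resolventNumerator (adjMat ℚ G) 0 = resolventNumerator (adjMat ℚ H) 0 := by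
  apply eq_of_infinite_eval_eq
  have hfin : {s : ℚ | (adjMat ℚ G).charpoly.IsRoot s}.Finite :=
    finite_setOfPred_isRoot (charpoly_monic _).ne_zero
  refine hfin.infinite_compl.mono fun s hs => ?_
  have hs' : (adjMat ℚ G).charpoly.eval s ≠ 0 := hs
  have hG := eval_charpoly_compl G s hs'
  have hH := eval_charpoly_compl H s (h.1 ▸ hs')
  rw [← h.2, ← h.1, hG] at hH
  exact add_left_cancel (mul_left_cancel₀ (pow_ne_zero _ (by norm_num)) hH)

open Polynomial in
/-- Generalized cospectral graphs have the same numbers of walks. -/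
theorem GenCospectral.walkCount_eq {n : ℕ} (hn : 0 < n) {G H : SimpleGraph (Fin n)}
    (h : GenCospectral G H) (k : ℕ) :
    (fun _ => 1) ⬝ᵥ ((adjMat ℚ G ^ k) *ᵥ fun _ => 1) =
      (fun _ => 1) ⬝ᵥ ((adjMat ℚ H ^ k) *ᵥ fun _ => 1) := by
  set A := adjMat ℚ G with hA
  set B := adjMat ℚ H with hB
  have hcoeff : ∀ (M : Matrix (Fin n) (Fin n) ℚ) (l : ℕ),
      (fun _ => 1) ⬝ᵥ ((M ^ l) *ᵥ fun _ => 1) = (resolventNumerator M l).coeff (n - 1) := by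
    intro M l
    have h1 := congrArg (fun p => p.coeff (n - 1 + 1)) (X_mul_resolventNumerator_sub M l)
    simp only [coeff_sub, coeff_X_mul, coeff_mul_C] at h1
    rw [coeff_eq_zero_of_natDegree_lt (Nat.lt_succ_of_le (natDegree_resolventNumerator_le M _)),
      sub_zero, Nat.sub_add_cancel hn] at h1
    have h2 : M.charpoly.coeff n = 1 := by
      have := (charpoly_monic M).coeff_natDegree
      rwa [charpoly_natDegree_eq_dim, Fintype.card_fin] at this
    rw [h1, h2, one_mul]
  have hnum : ∀ l, resolventNumerator A l = resolventNumerator B l := by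
    intro l
    induction l with
    | zero => exact h.resolventNumerator_zero_eq
    | succ l ih =>
      have h1 := X_mul_resolventNumerator_sub A l
      have h2 := X_mul_resolventNumerator_sub B l
      rw [hcoeff A l, ih, h.1, ← hB, ← hcoeff B l, ← h2] at h1
      exact sub_right_injective h1
  rw [hcoeff, hcoeff, hnum]

theorem adjMat_transpose {n : ℕ} (G : SimpleGraph (Fin n)) : (adjMat ℚ G)ᵀ = adjMat ℚ G := by
  ext i j
  have h : G.Adj j i ↔ G.Adj i j := G.adj_comm j i
  by_cases hij : G.Adj i j <;> simp [adjMat, h, hij]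

theorem walkMatrix_gram {n : ℕ} (A : Matrix (Fin n) (Fin n) ℚ) (hA : Aᵀ = A) (l : ℕ)
    (i j : Fin n) :
    ((walkMatrix A)ᵀ * A ^ l * walkMatrix A) i j =
      (fun _ => 1) ⬝ᵥ ((A ^ ((i : ℕ) + l + j)) *ᵥ fun _ => 1) := by
  have hpow : (A ^ (i : ℕ))ᵀ = A ^ (i : ℕ) := by rw [transpose_pow, hA]
  have h1 : ((walkMatrix A)ᵀ * A ^ l * walkMatrix A) i j =
      ((A ^ (i : ℕ)) *ᵥ fun _ => 1) ⬝ᵥ (A ^ l *ᵥ ((A ^ (j : ℕ)) *ᵥ fun _ => 1)) := by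
    rw [Matrix.mul_assoc]
    rfl
  rw [h1, mulVec_mulVec, ← pow_add, dotProduct_comm, dotProduct_mulVec, ← mulVec_transpose, hpow,
    mulVec_mulVec, ← pow_add, dotProduct_comm, add_assoc]

theorem walkMatrix_mulVec_single {n : ℕ} (hn : 0 < n) (A : Matrix (Fin n) (Fin n) ℚ) :
    walkMatrix A *ᵥ Pi.single ⟨0, hn⟩ 1 = fun _ => 1 := by
  rw [mulVec_single_one]
  funext i
  simp [walkMatrix, col]

/-- The rational regular orthogonal matrix conjugating a controllable graph to a generalized
cospectral one. -/
theorem GenCospectral.exists_orthogonal {n : ℕ} (hn : 0 < n) {G H : SimpleGraph (Fin n)}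
    (h : GenCospectral G H) (hdet : (walkMatrix (adjMat ℚ G)).det ≠ 0) :
    ∃ Q : Matrix (Fin n) (Fin n) ℚ, Qᵀ * Q = 1 ∧ Q *ᵥ (fun _ => 1) = (fun _ => 1) ∧
      Qᵀ * adjMat ℚ G * Q = adjMat ℚ H ∧
      Qᵀ * walkMatrix (adjMat ℚ G) = walkMatrix (adjMat ℚ H) := by
  set A := adjMat ℚ G with hA
  set B := adjMat ℚ H with hB
  set U := walkMatrix A with hU
  set V := walkMatrix B with hV
  have key : ∀ l : ℕ, Uᵀ * A ^ l * U = Vᵀ * B ^ l * V := by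
    intro l
    ext i j
    rw [walkMatrix_gram A (adjMat_transpose G), walkMatrix_gram B (adjMat_transpose H),
      h.walkCount_eq hn]
  have k0 : Uᵀ * U = Vᵀ * V := by simpa using key 0
  have k1 : Uᵀ * A * U = Vᵀ * B * V := by simpa using key 1
  have hVdet : V.det ≠ 0 := by
    intro h0
    have := congrArg det k0
    rw [det_mul, det_mul, h0, mul_zero, det_transpose] at this
    exact hdet (mul_self_eq_zero.1 this)
  have hVu : IsUnit V.det := isUnit_iff_ne_zero.2 hVdet
  have hVtu : IsUnit Vᵀ.det := by rwa [det_transpose]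
  have hQ : (U * V⁻¹)ᵀ * U = V := by
    rw [transpose_mul, transpose_nonsing_inv, Matrix.mul_assoc, k0,
      nonsing_inv_mul_cancel_left _ _ hVtu]
  refine ⟨U * V⁻¹, ?_, ?_, ?_, hQ⟩
  · rw [← Matrix.mul_assoc, hQ, mul_nonsing_inv _ hVu]
  · have hV1 : V⁻¹ *ᵥ (fun _ => 1) = Pi.single ⟨0, hn⟩ 1 := by
      rw [← walkMatrix_mulVec_single hn B, mulVec_mulVec, nonsing_inv_mul _ hVu, one_mulVec]
    rw [← mulVec_mulVec, hV1, walkMatrix_mulVec_single]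
  · rw [transpose_mul, transpose_nonsing_inv]
    calc Vᵀ⁻¹ * Uᵀ * A * (U * V⁻¹) = Vᵀ⁻¹ * (Uᵀ * A * U) * V⁻¹ := by
          simp only [Matrix.mul_assoc]
      _ = B := by
          rw [k1, Matrix.mul_assoc Vᵀ B V, nonsing_inv_mul_cancel_left _ _ hVtu,
            mul_nonsing_inv_cancel_right _ _ hVu]

theorem map_walkMatrix_adjMat {n : ℕ} (G : SimpleGraph (Fin n)) :
    (walkMatrix (adjMat ℤ G)).map (Int.castRingHom ℚ) = walkMatrix (adjMat ℚ G) := by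
  have h : (adjMat ℤ G).map (Int.castRingHom ℚ) = adjMat ℚ G := by
    ext i j
    simp only [adjMat, map_apply, of_apply]
    split_ifs <;> simp
  ext i j
  have hp : ((adjMat ℤ G) ^ (j : ℕ)).map (Int.castRingHom ℚ) = adjMat ℚ G ^ (j : ℕ) := by
    rw [← h]; exact map_pow (Int.castRingHom ℚ).mapMatrix _ _
  simp only [walkMatrix, map_apply, of_apply, ← hp, mulVec, dotProduct, map_sum, mul_one]

/-- If `D` is a multiple of all invariant factors of `W`, then `D • 1` is a left multiple of `W`. -/
theorem exists_mul_eq_smul_one {n : ℕ} {W : Matrix (Fin n) (Fin n) ℤ} {d : Fin n → ℤ} {D : ℤ}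
    (hd : ∀ i, d i ∣ D)
    (hsnf : ∃ U V : Matrix (Fin n) (Fin n) ℤ, IsUnit U.det ∧ IsUnit V.det ∧
      U * W * V = Matrix.diagonal d) :
    ∃ M : Matrix (Fin n) (Fin n) ℤ, W * M = D • (1 : Matrix (Fin n) (Fin n) ℤ) := by
  obtain ⟨U, V, hU, hV, h⟩ := hsnf
  choose c hc using hd
  refine ⟨V * diagonal c * U, ?_⟩
  have hW : W * V = U⁻¹ * diagonal d := by
    rw [← h, Matrix.mul_assoc, nonsing_inv_mul_cancel_left _ _ hU]
  have hdc : diagonal d * diagonal c = D • (1 : Matrix (Fin n) (Fin n) ℤ) := by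
    rw [diagonal_mul_diagonal, smul_one_eq_diagonal]
    congr 1
    funext i
    exact (hc i).symm
  rw [← Matrix.mul_assoc, ← Matrix.mul_assoc, hW, Matrix.mul_assoc U⁻¹, hdc, Matrix.mul_smul,
    Matrix.mul_one, Matrix.smul_mul, nonsing_inv_mul _ hU]

theorem IsIntegralMat.of_transpose {n : ℕ} {M : Matrix (Fin n) (Fin n) ℚ}
    (h : IsIntegralMat Mᵀ) : IsIntegralMat M := fun i j => h j i

theorem IsLevel.dvd {n : ℕ} {Q : Matrix (Fin n) (Fin n) ℚ} {l k : ℕ} (hl : IsLevel Q l)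
    (hk : IsIntegralMat ((k : ℚ) • Q)) : l ∣ k := by
  rw [Nat.dvd_iff_mod_eq_zero]
  by_contra hne
  have hint : IsIntegralMat (((k % l : ℕ) : ℚ) • Q) := by
    intro i j
    obtain ⟨a, ha⟩ := hk i j
    obtain ⟨b, hb⟩ := hl.2.1 i j
    refine ⟨a - ((k / l : ℕ) : ℤ) * b, ?_⟩
    have hdiv : (k : ℚ) = l * (k / l : ℕ) + (k % l : ℕ) := by
      exact_mod_cast (Nat.div_add_mod k l).symm
    simp only [Matrix.smul_apply, smul_eq_mul] at ha hb ⊢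
    rw [Int.cast_sub, Int.cast_mul, Int.cast_natCast, ← ha, ← hb, hdiv]
    ring
  exact absurd (hl.2.2 _ (Nat.pos_of_ne_zero hne) hint) (not_le.2 (Nat.mod_lt _ hl.1))

theorem exists_isLevel {n : ℕ} {Q : Matrix (Fin n) (Fin n) ℚ} {k : ℕ} (hk : 0 < k)
    (hint : IsIntegralMat ((k : ℚ) • Q)) : ∃ l, IsLevel Q l := by
  classical
  have hex : ∃ l : ℕ, 0 < l ∧ IsIntegralMat ((l : ℚ) • Q) := ⟨k, hk, hint⟩
  exact ⟨Nat.find hex, (Nat.find_spec hex).1, (Nat.find_spec hex).2,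
    fun m hm h => Nat.find_min' hex ⟨hm, h⟩⟩

theorem isLevel_one {n : ℕ} : IsLevel (1 : Matrix (Fin n) (Fin n) ℚ) 1 := by
  refine ⟨one_pos, fun i j => ?_, fun k hk _ => hk⟩
  refine ⟨(1 : Matrix (Fin n) (Fin n) ℤ) i j, ?_⟩
  by_cases h : i = j
  · subst h; simp
  · simp [h]

theorem memQSet_of_conj_eq {n : ℕ} {G H : SimpleGraph (Fin n)} {Q : Matrix (Fin n) (Fin n) ℚ}
    (h1 : Qᵀ * Q = 1) (h2 : Q *ᵥ (fun _ => 1) = (fun _ => 1))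
    (h3 : Qᵀ * adjMat ℚ G * Q = adjMat ℚ H) : MemQSet G Q := by
  refine ⟨h1, h2, fun i j => ?_⟩
  rw [h3]
  by_cases h : H.Adj i j <;> simp [adjMat, h]

/-- Divisors of a number with known prime factors are determined by the valuations there. -/
theorem eq_of_padicValNat_eq_of_dvd {k : ℕ} {pr mm : Fin k → ℕ} {m D : ℕ}
    (hpr : ∀ i, (pr i).Prime) (hD : D = 2 ^ m * ∏ i, pr i ^ mm i) {a b : ℕ}
    (ha : a ∣ D) (hb : b ∣ D) (h2 : padicValNat 2 a = padicValNat 2 b)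
    (hp : ∀ i, padicValNat (pr i) a = padicValNat (pr i) b) : a = b := by
  have hD0 : D ≠ 0 := by
    rw [hD]
    exact mul_ne_zero (by positivity)
      (Finset.prod_ne_zero_iff.2 fun i _ => pow_ne_zero _ (hpr i).ne_zero)
  refine Nat.eq_of_factorization_eq' (ne_zero_of_dvd_ne_zero hD0 ha)
    (ne_zero_of_dvd_ne_zero hD0 hb) ?_
  ext p
  by_cases hpp : p.Prime
  · by_cases hpD : p ∣ D
    · rw [Nat.factorization_def _ hpp, Nat.factorization_def _ hpp]
      rw [hD, hpp.dvd_mul] at hpD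
      rcases hpD with h | h
      · rw [(Nat.prime_dvd_prime_iff_eq hpp Nat.prime_two).1 (hpp.dvd_of_dvd_pow h), h2]
      · obtain ⟨i, -, hi⟩ := (hpp.prime.dvd_finsetProd_iff _).1 h
        rw [(Nat.prime_dvd_prime_iff_eq hpp (hpr i)).1 (hpp.dvd_of_dvd_pow hi), hp i]
    · rw [Nat.factorization_eq_zero_of_not_dvd fun h => hpD (h.trans ha),
        Nat.factorization_eq_zero_of_not_dvd fun h => hpD (h.trans hb)]
  · rw [Nat.factorization_eq_zero_of_not_prime _ hpp, Nat.factorization_eq_zero_of_not_prime _ hpp]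

/-- Suppose the invariant factors of `W(G)` satisfy `d_{⌈n/2⌉} = 1`,
`d_{n-1} = 2` and `d_n = 2^{m₁} p₂^{m₂} ⋯ p_k^{m_k}` with `p₂, …, p_k` distinct
odd primes.  If `v_{p_i}(ℓ(Q)) ≤ ⌊m_i/2⌋` for each odd prime `p_i` and
`v_2(ℓ(Q)) ≤ m₁ - 1` for every `Q ∈ 𝒬(G)`, and each achievable level
corresponds to at most one graph, then `G` has at most
`m₁ ∏ (⌊m_i/2⌋ + 1) - 1` generalized cospectral mates. -/
theorem count_generalized_cospectral_mates
    {n : ℕ} (hn : 2 ≤ n) (G : SimpleGraph (Fin n))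
    (W : Matrix (Fin n) (Fin n) ℤ) (hW : W = walkMatrix (adjMat ℤ G))
    (hcontrol : W.det ≠ 0)
    (d : Fin n → ℤ) (hchain : ∀ i j : Fin n, i ≤ j → d i ∣ d j)
    (hsnf : ∃ U V : Matrix (Fin n) (Fin n) ℤ, IsUnit U.det ∧ IsUnit V.det ∧
      U * W * V = Matrix.diagonal d)
    (hdhalf : d ⟨(n + 1) / 2 - 1, by omega⟩ = 1)
    (hdpen : d ⟨n - 2, by omega⟩ = 2)
    (m₁ : ℕ) (k : ℕ) (pr : Fin k → ℕ) (mm : Fin k → ℕ)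
    (hpr : ∀ i, (pr i).Prime ∧ Odd (pr i))
    (hprinj : Function.Injective pr)
    (hdn : d ⟨n - 1, by omega⟩ = 2 ^ m₁ * ∏ i, (pr i : ℤ) ^ (mm i))
    (hbound : ∀ Q : Matrix (Fin n) (Fin n) ℚ, MemQSet G Q → ∀ ℓ : ℕ, IsLevel Q ℓ →
      (∀ i, padicValNat (pr i) ℓ ≤ mm i / 2) ∧ padicValNat 2 ℓ ≤ m₁ - 1)
    (hunique : ∀ (H₁ H₂ : SimpleGraph (Fin n)) (Q₁ Q₂ : Matrix (Fin n) (Fin n) ℚ)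
      (ℓ : ℕ), MemQSet G Q₁ → MemQSet G Q₂ →
      Q₁ᵀ * adjMat ℚ G * Q₁ = adjMat ℚ H₁ → Q₂ᵀ * adjMat ℚ G * Q₂ = adjMat ℚ H₂ →
      IsLevel Q₁ ℓ → IsLevel Q₂ ℓ → Nonempty (H₁ ≃g H₂)) :
    ∀ S : Finset (SimpleGraph (Fin n)),
      (∀ H ∈ S, GenCospectral G H ∧ ¬ Nonempty (G ≃g H)) →
      (∀ H₁ ∈ S, ∀ H₂ ∈ S, H₁ ≠ H₂ → ¬ Nonempty (H₁ ≃g H₂)) →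
      S.card ≤ m₁ * (∏ i, (mm i / 2 + 1)) - 1 := by
  classical
  intro S hS hSiso
  obtain ⟨D, hD⟩ : ∃ D : ℕ, D = 2 ^ m₁ * ∏ i, pr i ^ mm i := ⟨_, rfl⟩
  have hDd : d ⟨n - 1, by omega⟩ = (D : ℤ) := by rw [hdn, hD]; push_cast; rfl
  have hDpos : 0 < D := by
    rw [hD]
    exact Nat.mul_pos (by positivity) (Finset.prod_pos fun i _ => pow_pos (hpr i).1.pos _)
  have hm₁ : 0 < m₁ := by
    by_contra h0
    have h2 : (2 : ℤ) ∣ D := by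
      rw [← hDd, ← hdpen]
      exact hchain _ _ (Fin.mk_le_mk.2 (by omega))
    have h2' : 2 ∣ D := by exact_mod_cast h2
    rw [hD, Nat.eq_zero_of_not_pos h0, pow_zero, one_mul,
      Nat.prime_two.prime.dvd_finsetProd_iff] at h2'
    obtain ⟨i, -, hi⟩ := h2'
    exact (hpr i).2.not_two_dvd_nat (Nat.prime_two.dvd_of_dvd_pow hi)
  have hdet : (walkMatrix (adjMat ℚ G)).det ≠ 0 := by
    rw [← map_walkMatrix_adjMat, ← hW]
    have : (W.map (Int.castRingHom ℚ)).det = ((W.det : ℤ) : ℚ) :=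
      ((Int.castRingHom ℚ).map_det W).symm
    rw [this]
    exact_mod_cast hcontrol
  obtain ⟨M, hM⟩ := exists_mul_eq_smul_one (D := D)
    (fun i => hDd ▸ hchain i ⟨n - 1, by omega⟩ (Fin.le_def.2 (Nat.le_sub_one_of_lt i.2))) hsnf
  have hMQ : walkMatrix (adjMat ℚ G) * M.map (Int.castRingHom ℚ) = (D : ℚ) • 1 := by
    rw [← map_walkMatrix_adjMat, ← hW, ← Matrix.map_mul, hM]
    ext i j
    rw [map_apply, Matrix.smul_apply, Matrix.smul_apply]
    by_cases hij : i = j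
    · subst hij; simp
    · simp [hij]
  have hlev : ∀ H ∈ S, ∃ (Q : Matrix (Fin n) (Fin n) ℚ) (l : ℕ), MemQSet G Q ∧
      Qᵀ * adjMat ℚ G * Q = adjMat ℚ H ∧ IsLevel Q l ∧ l ∣ D := by
    intro H hH
    obtain ⟨Q, hQ1, hQ2, hQ3, hQ4⟩ := (hS H hH).1.exists_orthogonal (by omega) hdet
    have hint : IsIntegralMat ((D : ℚ) • Q) := by
      refine IsIntegralMat.of_transpose ?_
      have : ((D : ℚ) • Q)ᵀ =
          (walkMatrix (adjMat ℤ H) * M).map (Int.castRingHom ℚ) := by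
        rw [Matrix.map_mul, map_walkMatrix_adjMat, ← hQ4, Matrix.mul_assoc, hMQ, Matrix.mul_smul,
          Matrix.mul_one, transpose_smul]
      rw [this]
      exact fun i j => ⟨_, rfl⟩
    obtain ⟨l, hl⟩ := exists_isLevel hDpos hint
    exact ⟨Q, l, memQSet_of_conj_eq hQ1 hQ2 hQ3, hQ3, hl, hl.dvd hint⟩
  choose! Q l hQ hconj hl hlD using hlev
  let T : Finset (ℕ × (Fin k → ℕ)) :=
    Finset.range m₁ ×ˢ Fintype.piFinset fun i => Finset.range (mm i / 2 + 1)
  let f : SimpleGraph (Fin n) → ℕ × (Fin k → ℕ) :=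
    fun H => (padicValNat 2 (l H), fun i => padicValNat (pr i) (l H))
  have hT : T.card = m₁ * ∏ i, (mm i / 2 + 1) := by simp [T]
  have h0T : (0 : ℕ × (Fin k → ℕ)) ∈ T := by simp [T, hm₁]
  have hlevel_ext : ∀ a b : ℕ, a ∣ D → b ∣ D →
      (padicValNat 2 a, fun i => padicValNat (pr i) a) =
        (padicValNat 2 b, fun i => padicValNat (pr i) b) → a = b := fun a b ha hb h =>
    eq_of_padicValNat_eq_of_dvd (fun i => (hpr i).1) hD ha hb (Prod.ext_iff.1 h).1
      (congrFun (Prod.ext_iff.1 h).2)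
  have hone : MemQSet G 1 :=
    memQSet_of_conj_eq (H := G) (by simp) (by simp) (by simp)
  rw [← hT, ← Finset.card_erase_of_mem h0T]
  refine Finset.card_le_card_of_injOn f (fun H hH => ?_) fun H₁ h₁ H₂ h₂ h => ?_
  · have hb := hbound (Q H) (hQ H hH) (l H) (hl H hH)
    refine Finset.mem_coe.2 (Finset.mem_erase.2 ⟨fun h0 => ?_, ?_⟩)
    · have h1 : l H = 1 := hlevel_ext _ _ (hlD H hH) (one_dvd _)
        (h0.trans (by ext <;> simp))
      exact (hS H hH).2 (hunique G H 1 (Q H) 1 hone (hQ H hH) (by simp) (hconj H hH) isLevel_one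
        (h1 ▸ hl H hH))
    · simp only [T, f, Finset.mem_product, Finset.mem_range, Fintype.mem_piFinset]
      exact ⟨by omega, fun i => Nat.lt_succ_of_le (hb.1 i)⟩
  · by_contra hne
    have hll := hlevel_ext _ _ (hlD H₁ h₁) (hlD H₂ h₂) h
    exact hSiso H₁ h₁ H₂ h₂ hne (hunique H₁ H₂ (Q H₁) (Q H₂) (l H₁) (hQ _ h₁) (hQ _ h₂)
      (hconj _ h₁) (hconj _ h₂) (hl _ h₁) (hll ▸ hl _ h₂))
end
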